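/- Let P be a FASP program, I an interpretation of P, and U ⊆ B_P a subset of the Herbrand base. If I is a model of the completion comp(P) and U is unfounded with respect to I, then for each u ∈ U ∩ supp(I) there is some rule r ∈ P_u such that posbody(r) ∩ U ∩ supp(I) ≠ ∅. -/

import Mathlib

/-- A t-norm on `[0,1]`: an increasing (in each argument), commutative and associative
binary operator on `[0,1]` with neutral element `1`. -/
structure Tnorm where
  T : ℝ → ℝ → ℝ
  mem_Icc : ∀ x ∈ Set.Icc (0:ℝ) 1, ∀ y ∈ Set.Icc (0:ℝ) 1, T x y ∈ Set.Icc (0:ℝ) 1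
  mono : ∀ x ∈ Set.Icc (0:ℝ) 1, ∀ x' ∈ Set.Icc (0:ℝ) 1, ∀ y ∈ Set.Icc (0:ℝ) 1,
    ∀ y' ∈ Set.Icc (0:ℝ) 1, x ≤ x' → y ≤ y' → T x y ≤ T x' y'
  comm : ∀ x ∈ Set.Icc (0:ℝ) 1, ∀ y ∈ Set.Icc (0:ℝ) 1, T x y = T y x
  assoc : ∀ x ∈ Set.Icc (0:ℝ) 1, ∀ y ∈ Set.Icc (0:ℝ) 1, ∀ z ∈ Set.Icc (0:ℝ) 1,
    T (T x y) z = T x (T y z)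
  one_T : ∀ x ∈ Set.Icc (0:ℝ) 1, T 1 x = x

/-- Left continuity of a t-norm in each argument (on `[0,1]`). -/
def Tnorm.LeftContinuous (Tn : Tnorm) : Prop :=
  ∀ x ∈ Set.Icc (0:ℝ) 1, ∀ y ∈ Set.Icc (0:ℝ) 1,
    ContinuousWithinAt (fun t => Tn.T x t) (Set.Icc (0:ℝ) y) y ∧
    ContinuousWithinAt (fun t => Tn.T t y) (Set.Icc (0:ℝ) x) x

/-- The residual implicator of a t-norm: `I_T(x,y) = sup { λ ∈ [0,1] | T(x,λ) ≤ y }`. -/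
noncomputable def Tnorm.resid (Tn : Tnorm) (x y : ℝ) : ℝ :=
  sSup { l | l ∈ Set.Icc (0:ℝ) 1 ∧ Tn.T x l ≤ y }

/-- The n-ary extension of a t-norm: `T(b) = b`, `T(b₁,…,bₙ) = T(b₁, T(b₂,…,bₙ))`. -/
def Tnorm.listEval (Tn : Tnorm) : List ℝ → ℝ
  | [] => 1
  | [x] => x
  | x :: xs => Tn.T x (Tn.listEval xs)

/-- A negator: a decreasing `[0,1] → [0,1]` map with `N(0) = 1` and `N(1) = 0`. -/
structure Negator where
  N : ℝ → ℝ
  mem_Icc : ∀ x ∈ Set.Icc (0:ℝ) 1, N x ∈ Set.Icc (0:ℝ) 1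
  anti : ∀ x ∈ Set.Icc (0:ℝ) 1, ∀ y ∈ Set.Icc (0:ℝ) 1, x ≤ y → N y ≤ N x
  N_zero : N 0 = 1
  N_one : N 1 = 0

/-- A body element of a FASP rule: an atom, a constant from `[0,1]`, or a negated atom. -/
inductive Lit (α : Type*) where
  | pos : α → Lit α
  | const : ℝ → Lit α
  | neg : Negator → α → Lit α

/-- A FASP rule `a ← T(b₁,…,bₙ)`: a head (an atom or a constant in `[0,1]`), a body
(a list of extended literals, combined by the rule's t-norm). -/
structure Rule (α : Type*) where
  head : α ⊕ ℝ
  body : List (Lit α)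
  tnorm : Tnorm

/-- Well-formedness of a literal: constants must lie in `[0,1]`. -/
def Lit.WF {α : Type*} : Lit α → Prop
  | .const c => c ∈ Set.Icc (0:ℝ) 1
  | _ => True

/-- Well-formedness of a rule: nonempty body, constants in `[0,1]`, and a
left-continuous t-norm. -/
def Rule.WF {α : Type*} (r : Rule α) : Prop :=
  r.body ≠ [] ∧ (∀ l ∈ r.body, l.WF) ∧ r.tnorm.LeftContinuous ∧
    ∀ c : ℝ, r.head = Sum.inr c → c ∈ Set.Icc (0:ℝ) 1

/-- Well-formedness of a FASP program (a set of rules). -/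
def ProgramWF {α : Type*} (P : Set (Rule α)) : Prop := ∀ r ∈ P, r.WF

/-- An interpretation maps every atom to a value in `[0,1]`. -/
def IsInterp {α : Type*} (I : α → ℝ) : Prop := ∀ a, I a ∈ Set.Icc (0:ℝ) 1

/-- Evaluation of an extended literal: `I(c) = c`, `I(N(b)) = N(I(b))`. -/
def Lit.eval {α : Type*} (I : α → ℝ) : Lit α → ℝ
  | .pos a => I a
  | .const c => c
  | .neg n a => n.N (I a)

/-- Evaluation of a rule body: `I(body(r)) = T_r(I(b₁),…,I(bₙ))`. -/
def Rule.evalBody {α : Type*} (I : α → ℝ) (r : Rule α) : ℝ :=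
  r.tnorm.listEval (r.body.map (Lit.eval I))

/-- Evaluation of a rule head. -/
def evalHead {α : Type*} (I : α → ℝ) : α ⊕ ℝ → ℝ
  | .inl a => I a
  | .inr c => c

/-- The atoms occurring positively (non-negated) in the body of a rule. -/
def Rule.posbody {α : Type*} (r : Rule α) : Set α := { a | Lit.pos a ∈ r.body }

/-- The immediate consequence operator:
`Π_P(I)(a) = sup { I(body(r)) | r ∈ P_a }` (with `sup ∅ = 0`). -/
noncomputable def PiOp {α : Type*} (P : Set (Rule α)) (I : α → ℝ) : α → ℝ :=
  fun a => sSup { x | ∃ r ∈ P, r.head = Sum.inl a ∧ x = r.evalBody I }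

/-- `I` is a model of `P` iff `I(r) = I_r(I(body(r)), I(head(r))) = 1` for all `r ∈ P`. -/
def IsModel {α : Type*} (P : Set (Rule α)) (I : α → ℝ) : Prop :=
  ∀ r ∈ P, r.tnorm.resid (r.evalBody I) (evalHead I r.head) = 1

/-- The support of an interpretation: `supp(I) = { a | I(a) > 0 }`. -/
def supp {α : Type*} (I : α → ℝ) : Set α := { a | 0 < I a }

/-- `U` is unfounded w.r.t. `I`: for each `u ∈ U` and rule `r ∈ P_u`, either
`U ∩ posbody(r) ≠ ∅`, or `I(u) > I(body(r))`, or `I(body(r)) = 0`. -/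
def Unfounded {α : Type*} (P : Set (Rule α)) (I : α → ℝ) (U : Set α) : Prop :=
  ∀ u ∈ U, ∀ r ∈ P, r.head = Sum.inl u →
    (U ∩ r.posbody).Nonempty ∨ r.evalBody I < I u ∨ r.evalBody I = 0

/-- `I` is unfounded-free iff `supp(I) ∩ U = ∅` for every unfounded set `U`. -/
def UnfoundedFree {α : Type*} (P : Set (Rule α)) (I : α → ℝ) : Prop :=
  ∀ U : Set α, Unfounded P I U → supp I ∩ U = ∅

/-- An answer set of `P` is an unfounded-free model of `P`. -/
def IsAnswerSet {α : Type*} (P : Set (Rule α)) (I : α → ℝ) : Prop :=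
  IsModel P I ∧ UnfoundedFree P I

/-- The reduct of a literal w.r.t. `I`: every negated atom `N(b)` is replaced by the
constant `N(I(b))`. -/
def Lit.reduct {α : Type*} (I : α → ℝ) : Lit α → Lit α
  | .neg n a => .const (n.N (I a))
  | l => l

/-- The reduct of a rule w.r.t. `I`. -/
def Rule.reduct {α : Type*} (I : α → ℝ) (r : Rule α) : Rule α :=
  ⟨r.head, r.body.map (Lit.reduct I), r.tnorm⟩

/-- The reduct of a program: `P^I = { r^I | r ∈ P }`. -/
def reduct {α : Type*} (P : Set (Rule α)) (I : α → ℝ) : Set (Rule α) :=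
  (Rule.reduct I) '' P

/-- `F` is the least fixpoint of `Π_P` (among interpretations). -/
def IsLfp {α : Type*} (P : Set (Rule α)) (F : α → ℝ) : Prop :=
  IsInterp F ∧ PiOp P F = F ∧
    ∀ G : α → ℝ, IsInterp G → PiOp P G = G → ∀ a, F a ≤ G a

/-- `I` is a model of the completion `comp(P)`: for every atom `a`,
`I(a) = sup { I(body(r)) | r ∈ P_a }` (with `sup ∅ = 0`), and for every rule with a
constant head `c`, `I(body(r)) ≤ c`. -/
def ModelsComp {α : Type*} (P : Set (Rule α)) (I : α → ℝ) : Prop :=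
  (∀ a, I a = sSup { x | ∃ r ∈ P, r.head = Sum.inl a ∧ x = r.evalBody I }) ∧
  (∀ r ∈ P, ∀ c : ℝ, r.head = Sum.inr c → r.evalBody I ≤ c)

/-- Edge of the positive dependency graph of `P`: `(a,b)` iff some rule with head `a`
has `b` occurring positively in its body. -/
def depEdge {α : Type*} (P : Set (Rule α)) (a b : α) : Prop :=
  ∃ r ∈ P, r.head = Sum.inl a ∧ b ∈ r.posbody

/-- A loop of `P`: a nonempty set `L` of atoms such that any two elements of `L` are
joined by a path of positive length in the positive dependency graph all of whose
vertices lie in `L`. -/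
def IsLoop {α : Type*} (P : Set (Rule α)) (L : Set α) : Prop :=
  L.Nonempty ∧ ∀ a ∈ L, ∀ b ∈ L,
    Relation.TransGen (fun u v => depEdge P u v ∧ u ∈ L ∧ v ∈ L) a b

/-- `R⁻(P,L)`: the rules of `P` with head in `L` whose positive body is disjoint
from `L`. -/
def extRules {α : Type*} (P : Set (Rule α)) (L : Set α) : Set (Rule α) :=
  { r | r ∈ P ∧ (∃ a ∈ L, r.head = Sum.inl a) ∧ r.posbody ∩ L = ∅ }

/-- `I` satisfies the loop formula `LF(L,P)` iff
`max { I(l) | l ∈ L } ≤ max { I(body(r)) | r ∈ R⁻(P,L) }` (right-hand side `0` when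
`R⁻(P,L) = ∅`). -/
def SatLF {α : Type*} (P : Set (Rule α)) (L : Set α) (I : α → ℝ) : Prop :=
  sSup (I '' L) ≤ sSup { x | ∃ r ∈ extRules P L, x = r.evalBody I }

/-- A simple program: no rule body contains a negated atom. -/
def Simple {α : Type*} (P : Set (Rule α)) : Prop :=
  ∀ r ∈ P, ∀ l ∈ r.body, ∀ (n : Negator) (a : α), l ≠ Lit.neg n a

theorem Tnorm.T_le_left (Tn : Tnorm) {x y : ℝ} (hx : x ∈ Set.Icc (0:ℝ) 1)
    (hy : y ∈ Set.Icc (0:ℝ) 1) : Tn.T x y ≤ x := by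
  have h1 : (1:ℝ) ∈ Set.Icc (0:ℝ) 1 := by simp
  calc Tn.T x y ≤ Tn.T x 1 := Tn.mono x hx x hx y hy 1 h1 le_rfl hy.2
    _ = x := by rw [Tn.comm x hx 1 h1, Tn.one_T x hx]

theorem Tnorm.T_le_right (Tn : Tnorm) {x y : ℝ} (hx : x ∈ Set.Icc (0:ℝ) 1)
    (hy : y ∈ Set.Icc (0:ℝ) 1) : Tn.T x y ≤ y := by
  rw [Tn.comm x hx y hy]
  exact Tn.T_le_left hy hx

theorem Tnorm.listEval_mem_Icc (Tn : Tnorm) (xs : List ℝ)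
    (h : ∀ x ∈ xs, x ∈ Set.Icc (0:ℝ) 1) : Tn.listEval xs ∈ Set.Icc (0:ℝ) 1 := by
  induction xs using Tnorm.listEval.induct with
  | case1 => simp [Tnorm.listEval]
  | case2 x => exact h x (by simp)
  | case3 x xs hne ih =>
    rw [Tnorm.listEval.eq_3 _ _ _ hne]
    exact Tn.mem_Icc x (h x (by simp)) _ (ih fun y hy => h y (by simp [hy]))

theorem Tnorm.listEval_le_of_mem (Tn : Tnorm) (xs : List ℝ)
    (h : ∀ x ∈ xs, x ∈ Set.Icc (0:ℝ) 1) {y : ℝ} (hy : y ∈ xs) : Tn.listEval xs ≤ y := by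
  induction xs using Tnorm.listEval.induct with
  | case1 => simp at hy
  | case2 x => simp [Tnorm.listEval, List.mem_singleton.1 hy]
  | case3 x xs hne ih =>
    have hx := h x (by simp)
    have hxs : ∀ z ∈ xs, z ∈ Set.Icc (0:ℝ) 1 := fun z hz => h z (by simp [hz])
    have hT := Tn.listEval_mem_Icc xs hxs
    rw [Tnorm.listEval.eq_3 _ _ _ hne]
    rcases List.mem_cons.1 hy with rfl | hy
    · exact Tn.T_le_left hx hT
    · exact (Tn.T_le_right hx hT).trans (ih hxs hy)

theorem Lit.eval_mem_Icc {α : Type*} {I : α → ℝ} (hI : IsInterp I) {l : Lit α} (hl : l.WF) :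
    l.eval I ∈ Set.Icc (0:ℝ) 1 := by
  cases l with
  | pos a => exact hI a
  | const c => exact hl
  | neg n a => exact n.mem_Icc _ (hI a)

theorem Rule.evalBody_le_of_mem_posbody {α : Type*} {I : α → ℝ} (hI : IsInterp I) {r : Rule α}
    (hr : r.WF) {a : α} (ha : a ∈ r.posbody) : r.evalBody I ≤ I a := by
  refine r.tnorm.listEval_le_of_mem _ ?_ (List.mem_map.2 ⟨Lit.pos a, ha, rfl⟩)
  intro x hx
  obtain ⟨l, hl, rfl⟩ := List.mem_map.1 hx
  exact Lit.eval_mem_Icc hI (hr.2.1 l hl)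

/-- In a model of the completion of a finite program, the value of each atom in the support is
attained by the body of a rule for that atom. -/
theorem ModelsComp.exists_evalBody_eq {α : Type*} {P : Set (Rule α)} (hfin : P.Finite)
    {I : α → ℝ} (hcomp : ModelsComp P I) {u : α} (hu : u ∈ supp I) :
    ∃ r ∈ P, r.head = Sum.inl u ∧ I u = r.evalBody I := by
  have hpos : 0 < I u := hu
  have hsup := hcomp.1 u
  set S := { x | ∃ r ∈ P, r.head = Sum.inl u ∧ x = r.evalBody I }
  have hS : S.Finite := by
    refine (hfin.image (Rule.evalBody I)).subset ?_
    rintro x ⟨r, hr, -, rfl⟩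
    exact ⟨r, hr, rfl⟩
  have hne : S.Nonempty := by
    rw [Set.nonempty_iff_ne_empty]
    intro h
    rw [h, Real.sSup_empty] at hsup
    exact hpos.ne' hsup
  have hmem : I u ∈ S := hsup ▸ hne.csSup_mem hS
  exact hmem

/-- if `I` models the completion of `P` and `U` is unfounded w.r.t. `I`,
then each `u ∈ U ∩ supp(I)` has a rule `r ∈ P_u` with
`posbody(r) ∩ U ∩ supp(I) ≠ ∅`. -/
theorem unfounded_modelsComp_posbody {α : Type*} [Finite α]
    (P : Set (Rule α)) (hfin : P.Finite) (hwf : ProgramWF P)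
    (I : α → ℝ) (hI : IsInterp I) (U : Set α)
    (hcomp : ModelsComp P I) (hU : Unfounded P I U) :
    ∀ u ∈ U ∩ supp I, ∃ r ∈ P, r.head = Sum.inl u ∧
      (r.posbody ∩ U ∩ supp I).Nonempty := by
  rintro u ⟨huU, hu⟩
  obtain ⟨r, hr, hhead, heq⟩ := hcomp.exists_evalBody_eq hfin hu
  have hpos : 0 < r.evalBody I := heq ▸ hu
  rcases hU u huU r hr hhead with ⟨a, haU, ha⟩ | hlt | hzero
  · exact ⟨r, hr, hhead, a, ⟨ha, haU⟩,
      hpos.trans_le (Rule.evalBody_le_of_mem_posbody hI (hwf r hr) ha)⟩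
  · exact absurd heq hlt.ne'
  · exact absurd hzero hpos.ne'
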